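/- With G(ρ,δ) and S(ρ,δ) as defined below, lim_{ρ→(1/2)⁺} ( lim_{δ→0⁺} δ²·G(ρ,δ)/S(ρ,δ) ) = (4 − π)/(4√2). -/

import Mathlib

open MeasureTheory Real Filter

noncomputable def lam (ρ : ℝ) : ℝ := Real.sqrt (4*ρ^2 - 1)

/-- Area of the ball cell. -/
noncomputable def A (ρ : ℝ) : ℝ :=
  1 - lam ρ - ρ^2 * (Real.pi - 4 * Real.arctan (lam ρ))

noncomputable def R (ρ δ : ℝ) : ℝ :=
  Real.arctan (lam ρ)
    - Real.arctan ((lam ρ + 2*δ)/Real.sqrt (1 - 4*δ*(lam ρ + δ)))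

/-- Volume of the ball-piston configuration space. -/
noncomputable def G (ρ δ : ℝ) : ℝ :=
  (lam ρ + 2*δ) * A ρ
    - (1/24) * (2*δ*(lam ρ + 4*δ)
        + (1 - Real.sqrt (1 - 4*δ*(lam ρ + δ)))
            * (2 + 4*δ*(lam ρ + δ) + 3*(lam ρ)^2))
    - (1/2) * ρ^2 * (lam ρ + 2*δ) * R ρ δ

/-- Area of the ball-piston collision surface. -/
noncomputable def S (ρ δ : ℝ) : ℝ :=
  (1/(2*Real.sqrt 2))
      * ((lam ρ + 2*δ) * (2 - Real.sqrt (1 - 4*δ*(lam ρ + δ))) - lam ρ)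
    + Real.sqrt 2 * ρ^2 * R ρ δ


lemma S_hasDeriv (ρ δ : ℝ) (hρ : 1/2 < ρ) (hd : 0 < 1 - 4*δ*(lam ρ + δ)) :
    HasDerivAt (fun δ => S ρ δ) (√2 * (1 - √(1 - 4*δ*(lam ρ + δ)))) δ := by
  have hl : lam ρ ^ 2 = 4*ρ^2 - 1 := by
    unfold lam; exact Real.sq_sqrt (by nlinarith)
  have h1 : HasDerivAt (fun δ : ℝ => 1 - 4*δ*(lam ρ + δ)) (-(4*(lam ρ + 2*δ))) δ := by
    have := (((hasDerivAt_id δ).const_mul 4).mul ((hasDerivAt_id δ).const_add (lam ρ))).const_sub 1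
    refine this.congr_deriv ?_
    simp; ring
  have hs := h1.sqrt hd.ne'
  have hu : HasDerivAt (fun δ : ℝ => lam ρ + 2*δ) 2 δ := by
    simpa using ((hasDerivAt_id δ).const_mul 2).const_add (lam ρ)
  have hspos : 0 < √(1 - 4*δ*(lam ρ + δ)) := Real.sqrt_pos.2 hd
  have hssq : √(1 - 4*δ*(lam ρ + δ))^2 = 4*ρ^2 - (lam ρ + 2*δ)^2 := by
    rw [Real.sq_sqrt hd.le]; linarith
  have hR := ((hu.div hs hspos.ne').arctan).const_sub (Real.arctan (lam ρ))
  have h2 : √2 ^ 2 = (2:ℝ) := Real.sq_sqrt (by norm_num)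
  have h2p : 0 < √(2:ℝ) := by positivity
  have hS := (((hu.mul (hs.const_sub 2)).sub_const (lam ρ)).const_mul (1/(2*√2))).add
    (hR.const_mul (√2 * ρ^2))
  refine HasDerivAt.congr_deriv (f := fun δ => S ρ δ) hS ?_
  simp only [Pi.div_apply]
  set s := √(1 - 4*δ*(lam ρ + δ)) with hsdef
  set u := lam ρ + 2*δ with hudef
  have hw : 1 + (u/s)^2 = 4*ρ^2/s^2 := by
    field_simp; linarith
  have hρ0 : ρ ≠ 0 := by linarith
  have hR' : 1 / (1 + (u/s)^2) * ((2 * s - u * (-(4*u)/(2*s)))/s^2) = 2/s := by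
    rw [hw]; field_simp; linear_combination 4*hssq
  rw [hR']
  have h3 : 1/(2*√2) = √2/4 := by field_simp; linarith
  rw [h3]
  field_simp
  linear_combination 4*hssq

lemma S_lim (ρ : ℝ) (hρ : 1/2 < ρ) :
    Tendsto (fun δ => S ρ δ / δ^2) (nhdsWithin 0 (Set.Ioi 0)) (nhds (√2 * lam ρ)) := by
  have hc : Continuous (fun δ : ℝ => 1 - 4*δ*(lam ρ + δ)) := by fun_prop
  have hev : ∀ᶠ δ in nhds (0:ℝ), 0 < 1 - 4*δ*(lam ρ + δ) :=
    hc.continuousAt.eventually (lt_mem_nhds (by simp))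
  have hev' := hev.filter_mono (nhdsWithin_le_nhds (s := Set.Ioi 0))
  have hpos : ∀ᶠ δ in nhdsWithin (0:ℝ) (Set.Ioi 0), 0 < δ := eventually_mem_nhdsWithin
  refine HasDerivAt.lhopital_zero_nhdsGT (f' := fun δ => √2 * (1 - √(1 - 4*δ*(lam ρ + δ))))
    (g' := fun δ => 2*δ) ?_ ?_ ?_ ?_ ?_ ?_
  · filter_upwards [hev'] with δ h using S_hasDeriv ρ δ hρ h
  · filter_upwards with δ
    simpa using hasDerivAt_pow 2 δ
  · filter_upwards [hpos] with δ h
    positivity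
  · have := (S_hasDeriv ρ 0 hρ (by simp)).continuousAt.tendsto
    have h0 : S ρ 0 = 0 := by simp [S, R]; ring
    rw [h0] at this
    exact this.mono_left nhdsWithin_le_nhds
  · have : Continuous (fun δ : ℝ => δ^2) := by fun_prop
    have := this.tendsto 0
    simp only [ne_eq, OfNat.ofNat_ne_zero, not_false_eq_true, zero_pow] at this
    exact this.mono_left nhdsWithin_le_nhds
  · have hc2 : ContinuousAt (fun δ : ℝ => √2 * (2*(lam ρ + δ)) / (1 + √(1 - 4*δ*(lam ρ + δ)))) 0 := by
      apply ContinuousAt.div (by fun_prop) (by fun_prop)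
      positivity
    have ht := hc2.tendsto.mono_left (nhdsWithin_le_nhds (s := Set.Ioi 0))
    have hv : √2 * (2*(lam ρ + 0)) / (1 + √(1 - 4*0*(lam ρ + 0))) = √2 * lam ρ := by
      simp; ring
    rw [hv] at ht
    refine ht.congr' ?_
    filter_upwards [hev', hpos] with δ h hp
    have hs := Real.sq_sqrt h.le
    have : 0 ≤ √(1 - 4*δ*(lam ρ + δ)) := Real.sqrt_nonneg _
    set s := √(1 - 4*δ*(lam ρ + δ))
    rw [div_eq_div_iff (by positivity) (by positivity)]
    linear_combination √2 * hs

lemma G_lim (ρ : ℝ) : Tendsto (fun δ => G ρ δ) (nhdsWithin 0 (Set.Ioi 0))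
    (nhds (lam ρ * A ρ)) := by
  have hR : ContinuousAt (fun δ => R ρ δ) 0 := by
    unfold R
    refine continuousAt_const.sub (Real.continuous_arctan.continuousAt.comp ?_)
    exact ContinuousAt.div (by fun_prop) (by fun_prop) (by simp)
  have hG : ContinuousAt (fun δ => G ρ δ) 0 := by
    unfold G
    fun_prop
  have h := hG.tendsto.mono_left (nhdsWithin_le_nhds (s := Set.Ioi 0))
  have h0 : G ρ 0 = lam ρ * A ρ := by simp [G, R]
  rwa [h0] at h

theorem stmt_5 (L : ℝ → ℝ)
    (hL : ∀ ρ ∈ Set.Ioo (1/2 : ℝ) (1/Real.sqrt 2),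
      Tendsto (fun δ : ℝ => δ^2 * G ρ δ / S ρ δ)
        (nhdsWithin 0 (Set.Ioi 0)) (nhds (L ρ))) :
    Tendsto L (nhdsWithin (1/2) (Set.Ioo (1/2 : ℝ) (1/Real.sqrt 2)))
      (nhds ((4 - Real.pi)/(4*Real.sqrt 2))) := by
  have hA : Continuous (fun ρ => A ρ / √2) := by
    unfold A lam
    have := Real.continuous_arctan
    fun_prop
  have h := (hA.tendsto (1/2)).mono_left
    (nhdsWithin_le_nhds (s := Set.Ioo (1/2 : ℝ) (1/Real.sqrt 2)))
  have hl0 : lam (1/2) = 0 := by unfold lam; norm_num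
  have hv : A (1/2) / √2 = (4 - Real.pi)/(4*Real.sqrt 2) := by
    unfold A; rw [hl0]; simp; field_simp; ring
  rw [hv] at h
  refine h.congr' ?_
  filter_upwards [eventually_mem_nhdsWithin] with ρ hρ
  have hlp : 0 < lam ρ := Real.sqrt_pos.2 (by nlinarith [hρ.1])
  have h2p : 0 < √(2:ℝ) := by positivity
  have hlim := (G_lim ρ).div (S_lim ρ hρ.1) (by positivity)
  have he : lam ρ * A ρ / (√2 * lam ρ) = A ρ / √2 := by field_simp
  rw [he] at hlim
  refine tendsto_nhds_unique (hlim.congr ?_) (hL ρ hρ)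
  intro δ
  simp only [Pi.div_apply]
  rw [div_div_eq_mul_div, mul_comm]
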